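/- Let n ≥ 0 be an integer, s ∈ ℂ with Re(s) > 0, and g : ℝ → ℂ a function that is (n+1)-times continuously differentiable on an open set containing [1/2,1]. Then ∫_{1/2}^{1} (1−x)^{s−1}·g(x) dx = Σ_{l=0}^{n} (1/2)^{s+l} · g^{(l)}(1/2) / ((s)(s+1)⋯(s+l)) + (1/((s)(s+1)⋯(s+n))) · ∫_{1/2}^{1} (1−x)^{s+n}·g^{(n+1)}(x) dx, where both integrals converge absolutely. -/

import Mathlib

open MeasureTheory

theorem ContDiffOn.continuousOn_iteratedDeriv_of_isOpen {g : ℝ → ℂ} {U : Set ℝ} {n l : ℕ}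
    (hg : ContDiffOn ℝ n g U) (hU : IsOpen U) (hl : l ≤ n) :
    ContinuousOn (iteratedDeriv l g) U :=
  (hg.continuousOn_iteratedDerivWithin (mod_cast hl) hU.uniqueDiffOn).congr
    (iteratedDerivWithin_of_isOpen hU).symm

theorem ContDiffOn.hasDerivAt_iteratedDeriv_of_isOpen {g : ℝ → ℂ} {U : Set ℝ} {n l : ℕ}
    (hg : ContDiffOn ℝ n g U) (hU : IsOpen U) (hl : l < n) {x : ℝ} (hx : x ∈ U) :
    HasDerivAt (iteratedDeriv l g) (iteratedDeriv (l + 1) g x) x := by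
  rw [iteratedDeriv_succ, hasDerivAt_deriv_iff]
  exact ((hg.differentiableOn_iteratedDerivWithin (mod_cast hl) hU.uniqueDiffOn).congr
    (iteratedDerivWithin_of_isOpen hU).symm).differentiableAt (hU.mem_nhds hx)

theorem intervalIntegrable_sub_cpow_mul {a b : ℝ} {s : ℂ} (hs : 0 < s.re) {f : ℝ → ℂ}
    (hf : ContinuousOn f (Set.uIcc a b)) :
    IntervalIntegrable (fun x : ℝ => ((b - x : ℝ) : ℂ) ^ (s - 1) * f x) volume a b := by
  have h : IntervalIntegrable (fun x : ℝ => (x : ℂ) ^ (s - 1)) volume (b - a) 0 :=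
    intervalIntegral.intervalIntegrable_cpow' (by simpa using hs)
  have h' := h.comp_sub_left b
  simp only [sub_sub_cancel, sub_zero] at h'
  exact h'.mul_continuousOn hf

theorem integral_sub_cpow_mul_eq {a b : ℝ} (hab : a ≤ b) {s : ℂ} (hs : 0 < s.re) {f f' : ℝ → ℂ}
    (hf : ∀ x ∈ Set.uIcc a b, HasDerivAt f (f' x) x) (hf' : ContinuousOn f' (Set.uIcc a b)) :
    ∫ x in a..b, ((b - x : ℝ) : ℂ) ^ (s - 1) * f x =
      ((b - a : ℝ) : ℂ) ^ s * f a / s + s⁻¹ * ∫ x in a..b, ((b - x : ℝ) : ℂ) ^ s * f' x := by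
  have hs0 : s ≠ 0 := by rintro rfl; simp at hs
  have hv : ∀ x ∈ Set.Ioo (min a b) (max a b), HasDerivAt
      (fun x : ℝ => -(((b - x : ℝ) : ℂ) ^ s / s)) (((b - x : ℝ) : ℂ) ^ (s - 1)) x := by
    intro x hx
    rw [max_eq_right hab] at hx
    have h := ((hasDerivAt_ofReal_cpow_const (sub_ne_zero.2 hx.2.ne') hs0).comp_const_sub b x
      ).div_const s |>.neg
    convert! h using 1
    field_simp
  have h := intervalIntegral.integral_mul_deriv_eq_deriv_mul_of_hasDerivAt
    (u := f) (u' := f') (v := fun x : ℝ => -(((b - x : ℝ) : ℂ) ^ s / s))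
    (fun x hx => (hf x hx).continuousAt.continuousWithinAt)
    ((((Complex.continuous_ofReal_cpow_const hs).comp
      (continuous_const.sub continuous_id)).div_const s).neg.continuousOn)
    (fun x hx => hf x (Set.Ioo_subset_Icc_self hx)) hv hf'.intervalIntegrable
    (by simpa using intervalIntegrable_sub_cpow_mul hs (f := fun _ => 1) continuousOn_const)
  simp_rw [mul_comm _ (f _), mul_comm _ (f' _)]
  rw [h, ← intervalIntegral.integral_const_mul, sub_self, Complex.ofReal_zero,
    Complex.zero_cpow hs0]
  simp_rw [mul_neg, intervalIntegral.integral_neg]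
  rw [intervalIntegral.integral_congr (g := fun x => s⁻¹ * (f' x * ((b - x : ℝ) : ℂ) ^ s))
    (fun x _ => by simp only; ring)]
  ring

theorem integral_sub_cpow_mul_eq_sum {a b : ℝ} (hab : a ≤ b) {s : ℂ} (hs : 0 < s.re)
    {g : ℝ → ℂ} {U : Set ℝ} (hU : IsOpen U) (hUI : Set.uIcc a b ⊆ U) {n : ℕ}
    (hg : ContDiffOn ℝ n g U) :
    ∫ x in a..b, ((b - x : ℝ) : ℂ) ^ (s - 1) * g x =
      (∑ l ∈ Finset.range n, ((b - a : ℝ) : ℂ) ^ (s + l) * iteratedDeriv l g a /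
        ∏ i ∈ Finset.range (l + 1), (s + i)) +
      (∏ i ∈ Finset.range n, (s + i))⁻¹ *
        ∫ x in a..b, ((b - x : ℝ) : ℂ) ^ (s + n - 1) * iteratedDeriv n g x := by
  induction n with
  | zero => simp
  | succ n ih =>
    rw [ih (hg.of_le (mod_cast n.le_succ)), integral_sub_cpow_mul_eq hab
      (s := s + n) (by simpa using add_pos_of_pos_of_nonneg hs n.cast_nonneg)
      (fun x hx => hg.hasDerivAt_iteratedDeriv_of_isOpen hU n.lt_succ_self (hUI hx))
      ((hg.continuousOn_iteratedDeriv_of_isOpen hU le_rfl).mono hUI),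
      Finset.sum_range_succ, Finset.prod_range_succ,
      show s + ((n + 1 : ℕ) : ℂ) - 1 = s + n by push_cast; ring, mul_inv, div_eq_mul_inv,
      div_eq_mul_inv _ (_ * _), mul_inv]
    ring

/-- **Repeated integration by parts on `[1/2, 1]`.**
For `Re s > 0` and `g` that is `(n+1)`-times continuously differentiable on an
open set containing `[1/2, 1]`,
`∫_{1/2}^{1} (1-x)^{s-1} g(x) dx
  = Σ_{l=0}^{n} (1/2)^{s+l} g^{(l)}(1/2) / (s(s+1)⋯(s+l))
    + (s(s+1)⋯(s+n))⁻¹ ∫_{1/2}^{1} (1-x)^{s+n} g^{(n+1)}(x) dx`,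
with both integrals absolutely convergent. -/
theorem integration_by_parts_right (n : ℕ) (s : ℂ) (hs : 0 < s.re)
    (g : ℝ → ℂ) (U : Set ℝ) (hU : IsOpen U) (hUI : Set.Icc (1/2 : ℝ) 1 ⊆ U)
    (hg : ContDiffOn ℝ (n + 1) g U) :
    (∫ x in Set.Ico (1/2 : ℝ) 1, ((1 - x : ℝ) : ℂ) ^ (s - 1) * g x =
      (∑ l ∈ Finset.range (n + 1),
        (1/2 : ℂ) ^ (s + l) * iteratedDeriv l g (1/2) /
          ∏ i ∈ Finset.range (l + 1), (s + i)) +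
      (∏ i ∈ Finset.range (n + 1), (s + i))⁻¹ *
        ∫ x in Set.Ico (1/2 : ℝ) 1, ((1 - x : ℝ) : ℂ) ^ (s + n) * iteratedDeriv (n + 1) g x)
    ∧ IntegrableOn (fun x : ℝ => ((1 - x : ℝ) : ℂ) ^ (s - 1) * g x) (Set.Ico (1/2 : ℝ) 1)
    ∧ IntegrableOn (fun x : ℝ => ((1 - x : ℝ) : ℂ) ^ (s + n) * iteratedDeriv (n + 1) g x)
        (Set.Ico (1/2 : ℝ) 1) := by
  have hg' : ContDiffOn ℝ (n + 1 : ℕ) g U := mod_cast hg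
  have hab : (1 / 2 : ℝ) ≤ 1 := by norm_num
  rw [← Set.uIcc_of_le hab] at hUI
  have hsn : s + ((n + 1 : ℕ) : ℂ) - 1 = s + n := by push_cast; ring
  have hsn_pos : 0 < (s + ((n + 1 : ℕ) : ℂ)).re := by
    rw [Complex.add_re, Complex.natCast_re]; positivity
  refine ⟨?_, ?_, ?_⟩
  · have h := integral_sub_cpow_mul_eq_sum hab hs hU hUI hg'
    rw [hsn, show ((1 - 1 / 2 : ℝ) : ℂ) = 1 / 2 by push_cast; norm_num] at h
    simpa only [integral_Ico_eq_integral_Ioc, intervalIntegral.integral_of_le hab] using h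
  · exact (intervalIntegrable_iff_integrableOn_Ico_of_le hab).1
      (intervalIntegrable_sub_cpow_mul hs (hg.continuousOn.mono hUI))
  · rw [← hsn]
    exact (intervalIntegrable_iff_integrableOn_Ico_of_le hab).1
      (intervalIntegrable_sub_cpow_mul hsn_pos
        ((hg'.continuousOn_iteratedDeriv_of_isOpen hU le_rfl).mono hUI))
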